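/- Fix an integer n ≥ 1, positive integers a, b, a nonnegative integer c and a real p ≥ 1. For each sign pattern ε ∈ {+1,−1}ⁿ and each permutation ρ of {1,…,n}, let P_{ε,ρ} = {x ∈ ℝⁿ : ε(i)x_i ≥ 0 for all i, and |x_{ρ(1)}| ≤ |x_{ρ(2)}| ≤ ⋯ ≤ |x_{ρ(n)}|}. Let ξ ≥ 0 and s > −d_n − ξ be reals, and let f : ℝⁿ∖{0} → ℝ be positively homogeneous of degree s such that the product f(x)·f_{a,b,c}(x) is C¹ in the interior of each set P_{ε,ρ}, with partial derivatives extending continuously to P_{ε,ρ} ∖ {0}. Then (ξ + c + 1)·M_p(f(x)·∑_{i=1}^n |x_i|^ξ) = p·M_p(‖x‖_{ξ+p}^{ξ+p}·f(x)) − M_p(∑_{i=1}^n |x_i|^ξ x_i ∂f/∂x_i(x)) − a·b·M_p(f(x)·∑_{i=1}^n ∑_{j≠i} |x_i|^ξ x_i^a/(x_i^a − x_j^a)), where the integrand of the last term is defined almost everywhere with respect to the density f_{a,b,c}, which vanishes on the set where x_i^a = x_j^a for some i ≠ j. -/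

import Mathlib

open MeasureTheory Real

/-- The density `∏_{i<j} |x_i^a - x_j^a|^b · ∏_i |x_i|^c` on `ℝⁿ`. -/
noncomputable def fabc (n a b c : ℕ) (x : Fin n → ℝ) : ℝ :=
  (∏ i : Fin n, ∏ j : Fin n, if i < j then |x i ^ a - x j ^ a| ^ b else 1) *
    ∏ i : Fin n, |x i| ^ c

/-- `M_p(g) = ∫ g(x) f_{a,b,c}(x) exp(-‖x‖_p^p) dx`. -/
noncomputable def Mp (n a b c : ℕ) (p : ℝ) (g : (Fin n → ℝ) → ℝ) : ℝ :=
  ∫ x : Fin n → ℝ, g x * fabc n a b c x * Real.exp (-∑ i, |x i| ^ p)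

/-- `d_n = a b n (n-1)/2 + (c+1) n`, as a real number. -/
noncomputable def dnR (n a b c : ℕ) : ℝ :=
  (a : ℝ) * b * n * ((n : ℝ) - 1) / 2 + ((c : ℝ) + 1) * n

/-- The cell `P_{ε,ρ} = {x : ε_i x_i ≥ 0 ∀ i, |x_{ρ(1)}| ≤ ⋯ ≤ |x_{ρ(n)}|}`. -/
def Pcell (n : ℕ) (ε : Fin n → ℝ) (ρ : Equiv.Perm (Fin n)) : Set (Fin n → ℝ) :=
  {x | (∀ i, 0 ≤ ε i * x i) ∧ ∀ i j : Fin n, i ≤ j → |x (ρ i)| ≤ |x (ρ j)|}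


/-- complement of the walls -/
def Uset (n : ℕ) : Set (Fin n → ℝ) :=
  {x | (∀ i, x i ≠ 0) ∧ ∀ i j, i ≠ j → x i ^ 2 ≠ x j ^ 2}

lemma Uset_open (n : ℕ) : IsOpen (Uset n) := by
  have : Uset n = (⋂ i, {x : Fin n → ℝ | x i ≠ 0}) ∩
      ⋂ i, ⋂ j, {x : Fin n → ℝ | i ≠ j → x i ^ 2 ≠ x j ^ 2} := by
    ext x; simp [Uset]
  rw [this]
  refine IsOpen.inter ?_ ?_
  · exact isOpen_iInter_of_finite fun i => isOpen_ne_fun (by fun_prop) (by fun_prop)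
  · refine isOpen_iInter_of_finite fun i => isOpen_iInter_of_finite fun j => ?_
    by_cases h : i = j
    · simp [h]
    · simp only [ne_eq, h, not_false_eq_true, forall_const]
      exact isOpen_ne_fun (by fun_prop) (by fun_prop)

lemma null_of_lin {n : ℕ} (L : (Fin n → ℝ) →ₗ[ℝ] ℝ) (x : Fin n → ℝ) (h : L x ≠ 0) :
    ∀ᵐ y : Fin n → ℝ, L y ≠ 0 := by
  have := Measure.addHaar_submodule (volume : Measure (Fin n → ℝ)) (LinearMap.ker L) (by
    intro h'
    have : x ∈ LinearMap.ker L := by rw [h']; trivial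
    exact h this)
  rw [ae_iff]
  convert this using 2
  ext y; simp

lemma Uset_ae (n : ℕ) : ∀ᵐ x : Fin n → ℝ, x ∈ Uset n := by
  have h1 : ∀ i : Fin n, ∀ᵐ x : Fin n → ℝ, x i ≠ 0 := fun i =>
    null_of_lin (LinearMap.proj i) (Pi.single i 1) (by simp)
  have h2 : ∀ i j : Fin n, ∀ᵐ x : Fin n → ℝ, i ≠ j → x i ^ 2 ≠ x j ^ 2 := by
    intro i j
    by_cases h : i = j
    · simp [h]
    have e1 := null_of_lin (LinearMap.proj (R := ℝ) (φ := fun _ : Fin n => ℝ) i + (-1 : ℝ) • LinearMap.proj (R := ℝ) (φ := fun _ : Fin n => ℝ) j)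
      (Pi.single i 1) (by
        change (Pi.single i (1:ℝ) : Fin n → ℝ) i + (-1) * (Pi.single i (1:ℝ) : Fin n → ℝ) j ≠ 0
        simp [h])
    have e2 := null_of_lin (LinearMap.proj (R := ℝ) (φ := fun _ : Fin n => ℝ) i + LinearMap.proj (R := ℝ) (φ := fun _ : Fin n => ℝ) j)
      (Pi.single i 1) (by
        change (Pi.single i (1:ℝ) : Fin n → ℝ) i + (Pi.single i (1:ℝ) : Fin n → ℝ) j ≠ 0
        simp [h])
    filter_upwards [e1, e2] with x h1 h2 _ h3
    change x i + (-1) * x j ≠ 0 at h1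
    change x i + x j ≠ 0 at h2
    have : (x i - x j) * (x i + x j) = 0 := by ring_nf; linarith
    rcases mul_eq_zero.1 this with h | h
    · exact h1 (by linarith)
    · exact h2 h
  have h1' := ae_all_iff.2 h1
  have h2' := ae_all_iff.2 fun i => ae_all_iff.2 (h2 i)
  filter_upwards [h1', h2'] with x a b using ⟨a, b⟩

/-- strict cell -/
def Scell (n : ℕ) (ε : Fin n → ℝ) (ρ : Equiv.Perm (Fin n)) : Set (Fin n → ℝ) :=
  {x | (∀ i, 0 < ε i * x i) ∧ ∀ i j : Fin n, i < j → ε (ρ i) * x (ρ i) < ε (ρ j) * x (ρ j)}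

lemma Scell_open (n : ℕ) (ε : Fin n → ℝ) (ρ : Equiv.Perm (Fin n)) : IsOpen (Scell n ε ρ) := by
  have : Scell n ε ρ = (⋂ i, {x : Fin n → ℝ | 0 < ε i * x i}) ∩
      ⋂ i, ⋂ j, {x : Fin n → ℝ | i < j → ε (ρ i) * x (ρ i) < ε (ρ j) * x (ρ j)} := by
    ext x; simp [Scell]
  rw [this]
  refine IsOpen.inter ?_ ?_
  · exact isOpen_iInter_of_finite fun i => isOpen_lt (by fun_prop) (by fun_prop)
  · refine isOpen_iInter_of_finite fun i => isOpen_iInter_of_finite fun j => ?_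
    by_cases h : i < j
    · simp only [h, forall_const]
      exact isOpen_lt (by fun_prop) (by fun_prop)
    · simp [h]

lemma eps_abs {e x : ℝ} (he : e = 1 ∨ e = -1) (h : 0 ≤ e * x) : |x| = e * x := by
  rcases he with rfl | rfl
  · simp at h ⊢; exact h
  · simp at h ⊢; exact h

lemma Scell_sub (n : ℕ) (ε : Fin n → ℝ) (hε : ∀ i, ε i = 1 ∨ ε i = -1)
    (ρ : Equiv.Perm (Fin n)) : Scell n ε ρ ⊆ Pcell n ε ρ := by
  intro x hx
  refine ⟨fun i => (hx.1 i).le, fun i j hij => ?_⟩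
  rw [eps_abs (hε _) (hx.1 _).le, eps_abs (hε _) (hx.1 _).le]
  rcases hij.eq_or_lt with rfl | h
  · exact le_rfl
  · exact (hx.2 i j h).le

lemma Scell_sub_int (n : ℕ) (ε : Fin n → ℝ) (hε : ∀ i, ε i = 1 ∨ ε i = -1)
    (ρ : Equiv.Perm (Fin n)) : Scell n ε ρ ⊆ interior (Pcell n ε ρ) :=
  interior_maximal (Scell_sub n ε hε ρ) (Scell_open n ε ρ)

lemma Pcell_closed (n : ℕ) (ε : Fin n → ℝ) (ρ : Equiv.Perm (Fin n)) : IsClosed (Pcell n ε ρ) := by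
  have : Pcell n ε ρ = (⋂ i, {x : Fin n → ℝ | 0 ≤ ε i * x i}) ∩
      ⋂ i, ⋂ j, {x : Fin n → ℝ | i ≤ j → |x (ρ i)| ≤ |x (ρ j)|} := by
    ext x; simp [Pcell]
  rw [this]
  refine IsClosed.inter ?_ ?_
  · exact isClosed_iInter fun i => isClosed_le (by fun_prop) (by fun_prop)
  · refine isClosed_iInter fun i => isClosed_iInter fun j => ?_
    by_cases h : i ≤ j
    · simp only [h, forall_const]
      exact isClosed_le (by fun_prop) (by fun_prop)
    · simp [h]

/-- sign vector from a boolean vector -/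
noncomputable def bsgn {n : ℕ} (e : Fin n → Bool) (i : Fin n) : ℝ := if e i then 1 else -1

lemma bsgn_or {n : ℕ} (e : Fin n → Bool) (i : Fin n) : bsgn e i = 1 ∨ bsgn e i = -1 := by
  unfold bsgn; split_ifs <;> simp

lemma exists_Scell {n : ℕ} {x : Fin n → ℝ} (hx : x ∈ Uset n) :
    ∃ (e : Fin n → Bool) (ρ : Equiv.Perm (Fin n)), x ∈ Scell n (bsgn e) ρ := by
  classical
  refine ⟨fun i => decide (0 < x i), Tuple.sort (fun i => |x i|), ?_⟩
  have h0 : ∀ i, 0 < bsgn (fun i => decide (0 < x i)) i * x i := by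
    intro i
    have := hx.1 i
    unfold bsgn
    by_cases h : 0 < x i
    · simp [h]
    · have : x i < 0 := lt_of_le_of_ne (not_lt.1 h) this
      simp [h, this]
  refine ⟨h0, fun i j hij => ?_⟩
  have hm := Tuple.monotone_sort (fun i => |x i|) hij.le
  simp only [Function.comp] at hm
  rw [← eps_abs (bsgn_or _ _) (h0 _).le, ← eps_abs (bsgn_or _ _) (h0 _).le]
  refine lt_of_le_of_ne hm fun h => ?_
  refine hx.2 _ _ (fun h' => hij.ne ((Tuple.sort (fun i => |x i|)).injective h')) ((sq_eq_sq_iff_abs_eq_abs _ _).2 h)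

lemma Scell_sub_U {n : ℕ} {e : Fin n → ℝ} (he : ∀ i, e i = 1 ∨ e i = -1)
    {ρ : Equiv.Perm (Fin n)} : Scell n e ρ ⊆ Uset n := by
  intro x hx
  refine ⟨fun i h => by have := hx.1 i; simp [h] at this, fun i j hij h => ?_⟩
  rw [sq_eq_sq_iff_abs_eq_abs, eps_abs (he _) (hx.1 _).le, eps_abs (he _) (hx.1 _).le] at h
  have h2 := hx.2
  rcases lt_trichotomy (ρ.symm i) (ρ.symm j) with h' | h' | h'
  · have := h2 _ _ h'; simp at this; linarith
  · exact hij (ρ.symm.injective h')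
  · have := h2 _ _ h'; simp at this; linarith

lemma Scell_convex (n : ℕ) (ε : Fin n → ℝ) (ρ : Equiv.Perm (Fin n)) : Convex ℝ (Scell n ε ρ) := by
  intro x hx y hy s t hs ht hst
  have key : ∀ u v u' v' : ℝ, u < v → u' < v' → s * u + t * u' < s * v + t * v' := by
    intro u v u' v' h h'
    rcases hs.eq_or_lt with rfl | hs'
    · have : t = 1 := by linarith
      subst this; linarith
    · nlinarith [mul_lt_mul_of_pos_left h hs', mul_le_mul_of_nonneg_left h'.le ht]
  refine ⟨fun i => ?_, fun i j hij => ?_⟩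
  · have := key _ _ _ _ (hx.1 i) (hy.1 i)
    simp only [Pi.add_apply, Pi.smul_apply, smul_eq_mul]; linarith
  · have := key _ _ _ _ (hx.2 i j hij) (hy.2 i j hij)
    simp only [Pi.add_apply, Pi.smul_apply, smul_eq_mul]; linarith


lemma card_pairs (n : ℕ) :
    ((∑ i : Fin n, ∑ j : Fin n, if i < j then (1:ℝ) else 0)) = (n : ℝ) * (n - 1) / 2 := by
  have h1 : (∑ i : Fin n, ∑ j : Fin n, if i < j then (1:ℝ) else 0)
      = ∑ i : Fin n, ∑ j : Fin n, if j < i then (1:ℝ) else 0 := by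
    rw [Finset.sum_comm]
  have h2 : (∑ i : Fin n, ∑ j : Fin n, if i < j then (1:ℝ) else 0)
      + (∑ i : Fin n, ∑ j : Fin n, if j < i then (1:ℝ) else 0)
      + (∑ i : Fin n, ∑ j : Fin n, if i = j then (1:ℝ) else 0) = n * n := by
    simp only [← Finset.sum_add_distrib]
    have : ∀ i j : Fin n, ((if i < j then (1:ℝ) else 0) + (if j < i then (1:ℝ) else 0))
      + (if i = j then (1:ℝ) else 0) = 1 := by
      intro i j
      rcases lt_trichotomy i j with h | h | h
      · simp [h, h.not_gt, h.ne]
      · simp [h]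
      · simp [h, h.not_gt, h.ne']
    simp [this]
  have h3 : (∑ i : Fin n, ∑ j : Fin n, if i = j then (1:ℝ) else 0) = n := by simp
  rw [← h1, h3] at h2
  linarith

lemma fabc_smul (n a b c : ℕ) (r : ℝ) (hr : 0 < r) (x : Fin n → ℝ) :
    fabc n a b c (r • x) = r ^ (dnR n a b c - n) * fabc n a b c x := by
  have e1 : ∀ i j : Fin n, (if i < j then |(r • x) i ^ a - (r • x) j ^ a| ^ b else 1)
      = r ^ ((a:ℝ) * b * (if i < j then (1:ℝ) else 0)) * (if i < j then |x i ^ a - x j ^ a| ^ b else 1) := by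
    intro i j
    split_ifs with h
    · simp only [Pi.smul_apply, smul_eq_mul, mul_pow, ← mul_sub, abs_mul, mul_one]
      rw [abs_of_pos (pow_pos hr a), ← pow_mul, ← Nat.cast_mul, rpow_natCast]
    · simp
  have e2 : ∀ i : Fin n, |(r • x) i| ^ c = r ^ (c : ℝ) * |x i| ^ c := by
    intro i
    simp [abs_mul, mul_pow, abs_of_pos hr]
  unfold fabc
  simp only [e1, e2, Finset.prod_mul_distrib, ← Real.rpow_sum_of_pos hr, ← Finset.mul_sum, card_pairs]
  simp only [Finset.sum_const, Finset.card_univ, Fintype.card_fin, nsmul_eq_mul]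
  have : dnR n a b c - n = a * b * (n * (n - 1) / 2) + n * c := by unfold dnR; ring
  rw [this, rpow_add hr]
  ring

lemma norm_le_exp {n : ℕ} (hn : 1 ≤ n) (x : Fin n → ℝ) (p : ℝ) :
    Real.exp (-∑ i, |x i| ^ p) ≤ Real.exp (-‖x‖ ^ p) := by
  have : Nonempty (Fin n) := ⟨⟨0, hn⟩⟩
  obtain ⟨i, hi⟩ : ∃ i, ‖x i‖ = ‖x‖ := by
    obtain ⟨i, hi⟩ := Finite.exists_max (fun i => ‖x i‖)
    exact ⟨i, le_antisymm (norm_le_pi_norm x i) ((pi_norm_le_iff_of_nonneg (norm_nonneg _)).2 hi)⟩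
  apply Real.exp_le_exp.2
  have := Finset.single_le_sum (f := fun i => |x i| ^ p) (fun i _ => by positivity) (Finset.mem_univ i)
  rw [← hi, Real.norm_eq_abs]
  linarith

lemma integrable_norm_rpow_exp {n : ℕ} (hn : 1 ≤ n) (p t : ℝ) (hp : 1 ≤ p) (ht : -(n : ℝ) < t) :
    Integrable (fun x : Fin n → ℝ => ‖x‖ ^ t * Real.exp (-‖x‖ ^ p)) := by
  have : Nonempty (Fin n) := ⟨⟨0, hn⟩⟩
  have := (integrable_fun_norm_addHaar (volume : Measure (Fin n → ℝ))
    (f := fun y => y ^ t * Real.exp (-y ^ p))).2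
  apply this
  have h := integrableOn_rpow_mul_exp_neg_rpow (p := p) (s := t + n - 1) (by linarith) (by linarith)
  refine h.congr_fun (fun y hy => ?_) measurableSet_Ioi
  simp only [smul_eq_mul, Module.finrank_fin_fun]
  rw [← mul_assoc, ← rpow_natCast, Nat.cast_sub hn, ← rpow_add hy]
  congr 2
  push_cast; ring

lemma integrable_of_bound {n : ℕ} (hn : 1 ≤ n) (p t : ℝ) (hp : 1 ≤ p) (ht : -(n : ℝ) < t)
    (ψ : (Fin n → ℝ) → ℝ) (hψ : ContinuousOn ψ (Uset n)) (C : ℝ)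
    (hC : ∀ x ∈ Uset n, |ψ x| ≤ C * ‖x‖ ^ t) :
    Integrable (fun x => ψ x * Real.exp (-∑ i, |x i| ^ p)) := by
  refine ((integrable_norm_rpow_exp hn p t hp ht).const_mul C).mono' ?_ ?_
  · have hm : (volume : Measure (Fin n → ℝ)).restrict (Uset n) = volume :=
      Measure.restrict_eq_self_of_ae_mem (Uset_ae n)
    rw [← hm]
    refine ContinuousOn.aestronglyMeasurable ?_ (Uset_open n).measurableSet
    refine hψ.mul (Continuous.continuousOn ?_)
    have : Continuous fun x : Fin n → ℝ => ∑ i, |x i| ^ p := by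
      refine continuous_finsetSum _ fun i _ => ?_
      exact Continuous.rpow_const (by fun_prop) fun x => Or.inr (by linarith)
    fun_prop
  · filter_upwards [Uset_ae n] with x hx
    rw [norm_mul, Real.norm_eq_abs, Real.norm_eq_abs, Real.abs_exp, ← mul_assoc]
    exact mul_le_mul (hC x hx) (norm_le_exp hn x p) (by positivity) ((abs_nonneg _).trans (hC x hx))

lemma ibp_compact {n : ℕ} (U K : Set (Fin n → ℝ)) (hU : IsOpen U) (hK : IsCompact K) (hKU : K ⊆ U)
    (G : (Fin n → ℝ) → ℝ) (hG : ContDiffOn ℝ 1 G U) (v : Fin n → ℝ) (h0 : ∀ x ∉ K, G x = 0) :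
    Integrable (fun x => fderiv ℝ G x v) ∧ ∫ x, fderiv ℝ G x v = 0 := by
  have hC : ContDiff ℝ 1 G := by
    rw [contDiff_iff_contDiffAt]
    intro x
    by_cases hx : x ∈ U
    · exact hG.contDiffAt (hU.mem_nhds hx)
    · have : G =ᶠ[nhds x] fun _ => 0 := by
        filter_upwards [hK.isClosed.isOpen_compl.mem_nhds (fun h => hx (hKU h))] with y hy
        exact h0 y hy
      exact contDiffAt_const.congr_of_eventuallyEq this
  have hs : HasCompactSupport G := HasCompactSupport.intro hK h0
  have hs' : HasCompactSupport (fun x => fderiv ℝ G x v) := hs.fderiv_apply (𝕜 := ℝ) v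
  have hc' : Continuous (fun x => fderiv ℝ G x v) :=
    (hC.continuous_fderiv one_ne_zero).clm_apply continuous_const
  have hi := hc'.integrable_of_hasCompactSupport (μ := volume) hs'
  refine ⟨hi, ?_⟩
  have := integral_mul_fderiv_eq_neg_fderiv_mul_of_integrable (μ := (volume : Measure (Fin n → ℝ)))
    (f := G) (g := fun _ => (1:ℝ)) (v := v) (by simpa using hi) (by simp)
    (by simpa using hC.continuous.integrable_of_hasCompactSupport hs)
    (fun x _ => hC.differentiable one_ne_zero x) (fun x _ => by simp)
  simpa using this


lemma U_ne_zero {n : ℕ} (hn : 1 ≤ n) {x : Fin n → ℝ} (hx : x ∈ Uset n) : x ≠ 0 := by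
  rintro rfl
  exact hx.1 ⟨0, hn⟩ rfl

lemma U_smul {n : ℕ} {x : Fin n → ℝ} (hx : x ∈ Uset n) {r : ℝ} (hr : r ≠ 0) : r • x ∈ Uset n := by
  refine ⟨fun i => mul_ne_zero hr (hx.1 i), fun i j hij h => hx.2 i j hij ?_⟩
  simp only [Pi.smul_apply, smul_eq_mul, mul_pow] at h
  exact mul_left_cancel₀ (pow_ne_zero 2 hr) h

/-- the C1 hypothesis -/
def HC1 {n : ℕ} (F : (Fin n → ℝ) → ℝ) : Prop :=
  ∀ ε : Fin n → ℝ, (∀ i, ε i = 1 ∨ ε i = -1) → ∀ ρ : Equiv.Perm (Fin n),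
      ∃ g : (Fin n → ℝ) → (Fin n → ℝ) →L[ℝ] ℝ,
        ContinuousOn g (Pcell n ε ρ \ {0}) ∧
        ∀ x ∈ interior (Pcell n ε ρ), HasFDerivAt F (g x) x

lemma contDiffOn_F {n : ℕ} (hn : 1 ≤ n) {F : (Fin n → ℝ) → ℝ} (h : HC1 F) :
    ContDiffOn ℝ 1 F (Uset n) := by
  intro x hx
  apply ContDiffAt.contDiffWithinAt
  obtain ⟨e, ρ, hxe⟩ := exists_Scell hx
  obtain ⟨g, hg, hF⟩ := h (bsgn e) (bsgn_or e) ρ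
  rw [contDiffAt_one_iff]
  refine ⟨g, Scell n (bsgn e) ρ, (Scell_open _ _ _).mem_nhds hxe, ?_, ?_⟩
  · refine hg.mono fun y hy => ⟨Scell_sub _ _ (bsgn_or e) _ hy, ?_⟩
    exact U_ne_zero hn (Scell_sub_U (bsgn_or e) hy)
  · exact fun y hy => hF y (Scell_sub_int _ _ (bsgn_or e) _ hy)

lemma Pcell_norm {n : ℕ} (hn : 1 ≤ n) {ε : Fin n → ℝ} (hε : ∀ i, ε i = 1 ∨ ε i = -1)
    {ρ : Equiv.Perm (Fin n)} {x : Fin n → ℝ} (hx : x ∈ Pcell n ε ρ) :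
    ‖x‖ = ε (ρ ⟨n - 1, by omega⟩) * x (ρ ⟨n - 1, by omega⟩) := by
  rw [← eps_abs (hε _) (hx.1 _)]
  refine le_antisymm ((pi_norm_le_iff_of_nonneg (abs_nonneg _)).2 fun i => ?_) (norm_le_pi_norm x _)
  have := hx.2 (ρ.symm i) ⟨n - 1, by omega⟩ (by rw [Fin.le_def]; simp; omega)
  simpa using this

lemma cell_bound {n : ℕ} (hn : 1 ≤ n) {F : (Fin n → ℝ) → ℝ} (h : HC1 F) (ε : Fin n → ℝ)
    (hε : ∀ i, ε i = 1 ∨ ε i = -1) (ρ : Equiv.Perm (Fin n)) :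
    ∃ C : ℝ, ∀ x ∈ Scell n ε ρ, ‖x‖ = 1 → |F x| ≤ C ∧ ‖fderiv ℝ F x‖ ≤ C := by
  obtain ⟨g, hg, hF⟩ := h ε hε ρ
  have hcomp : IsCompact (Pcell n ε ρ ∩ Metric.sphere 0 1) :=
    (isCompact_sphere 0 1).inter_left (Pcell_closed n ε ρ)
  obtain ⟨C, hC⟩ := hcomp.exists_bound_of_continuousOn (f := g) (hg.mono fun x hx => ⟨hx.1, by
    rintro rfl; simpa using hx.2⟩)
  set S := Scell n ε ρ ∩ {x | ε (ρ ⟨n - 1, by omega⟩) * x (ρ ⟨n - 1, by omega⟩) = 1} with hS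
  have hSc : Convex ℝ S := by
    refine (Scell_convex n ε ρ).inter ?_
    intro x hx y hy s t hs ht hst
    simp only [Set.mem_setOf_eq, Pi.add_apply, Pi.smul_apply, smul_eq_mul] at *
    linear_combination s * hx + t * hy + hst
  have hSm : ∀ x ∈ Scell n ε ρ, ‖x‖ = 1 → x ∈ S := by
    intro x hx h1
    refine ⟨hx, ?_⟩
    rw [Pcell_norm hn hε (Scell_sub _ _ hε _ hx)] at h1
    exact h1
  have hgS : ∀ x ∈ S, ‖g x‖ ≤ C := by
    intro x hx
    have h1 := Scell_sub _ _ hε _ hx.1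
    refine hC x ⟨h1, ?_⟩
    simp only [mem_sphere_iff_norm, sub_zero]
    rw [Pcell_norm hn hε h1]
    exact hx.2
  have hFS : ∀ x ∈ S, HasFDerivAt F (g x) x := fun x hx => hF x (Scell_sub_int _ _ hε _ hx.1)
  by_cases hne : S.Nonempty
  · obtain ⟨x0, hx0⟩ := hne
    have hC0 : 0 ≤ C := (norm_nonneg _).trans (hgS x0 hx0)
    have n0 : ‖x0‖ = 1 := by
      rw [Pcell_norm hn hε (Scell_sub _ _ hε _ hx0.1)]; exact hx0.2
    refine ⟨|F x0| + C * 2, fun x hx h1 => ?_⟩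
    have hxS := hSm x hx h1
    have := hSc.norm_image_sub_le_of_norm_hasFDerivWithin_le
      (fun y hy => (hFS y hy).hasFDerivWithinAt) hgS hx0 hxS
    have h2 : ‖x - x0‖ ≤ 2 := by
      calc ‖x - x0‖ ≤ ‖x‖ + ‖x0‖ := norm_sub_le _ _
        _ = 2 := by rw [h1, n0]; norm_num
    constructor
    · have h3 : |F x| ≤ |F x0| + |F x - F x0| := by
        have := abs_add_le (F x0) (F x - F x0); simpa using this
      rw [Real.norm_eq_abs] at this
      nlinarith
    · rw [(hFS x hxS).fderiv]
      have := hgS x hxS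
      have := abs_nonneg (F x0)
      linarith
  · exact ⟨0, fun x hx h1 => absurd ⟨x, hSm x hx h1⟩ hne⟩

lemma F_bound {n : ℕ} (hn : 1 ≤ n) {F : (Fin n → ℝ) → ℝ} (h : HC1 F) (σ : ℝ)
    (hhom : ∀ r : ℝ, 0 < r → ∀ x : Fin n → ℝ, x ≠ 0 → F (r • x) = r ^ σ * F x) :
    ∃ C : ℝ, 0 ≤ C ∧ ∀ x ∈ Uset n, |F x| ≤ C * ‖x‖ ^ σ ∧ ‖fderiv ℝ F x‖ ≤ C * ‖x‖ ^ (σ - 1) := by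
  have hc := fun q : (Fin n → Bool) × Equiv.Perm (Fin n) =>
    cell_bound hn h (bsgn q.1) (bsgn_or q.1) q.2
  choose C hC using hc
  have hb : ∀ x ∈ Uset n, ‖x‖ = 1 → |F x| ≤ ∑ q, |C q| ∧ ‖fderiv ℝ F x‖ ≤ ∑ q, |C q| := by
    intro x hx h1
    obtain ⟨e, ρ, hxe⟩ := exists_Scell hx
    have h2 := hC (e, ρ) x hxe h1
    have h3 : C (e, ρ) ≤ ∑ q, |C q| := (le_abs_self _).trans
      (Finset.single_le_sum (f := fun q => |C q|) (fun _ _ => abs_nonneg _) (Finset.mem_univ (e, ρ)))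
    exact ⟨h2.1.trans h3, h2.2.trans h3⟩
  refine ⟨∑ q, |C q|, Finset.sum_nonneg fun _ _ => abs_nonneg _, fun x hx => ?_⟩
  have hx0 := U_ne_zero hn hx
  have hr : 0 < ‖x‖ := norm_pos_iff.2 hx0
  set r := ‖x‖ with hrd
  set u := r⁻¹ • x with hu
  have huU : u ∈ Uset n := U_smul hx (inv_ne_zero hr.ne')
  have hu1 : ‖u‖ = 1 := by
    rw [hu, norm_smul, norm_inv, norm_norm, ← hrd, inv_mul_cancel₀ hr.ne']
  have hB := hb u huU hu1
  have hFx : F x = r ^ σ * F u := by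
    rw [← hhom r hr u (U_ne_zero hn huU), hu, smul_inv_smul₀ hr.ne']
  constructor
  · rw [hFx, abs_mul, abs_of_pos (rpow_pos_of_pos hr σ), mul_comm]
    exact mul_le_mul_of_nonneg_right hB.1 (by positivity)
  · have hd : HasFDerivAt F (fderiv ℝ F u) u :=
      (((contDiffOn_F hn h).contDiffAt ((Uset_open n).mem_nhds huU)).differentiableAt one_ne_zero).hasFDerivAt
    have hd2 : HasFDerivAt (fun y => r ^ σ * F (r⁻¹ • y))
        (r ^ σ • (fderiv ℝ F u).comp (r⁻¹ • ContinuousLinearMap.id ℝ (Fin n → ℝ))) x := by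
      refine HasFDerivAt.const_mul ?_ _
      exact HasFDerivAt.comp x (f := fun y => r⁻¹ • y) hd ((hasFDerivAt_id x).const_smul r⁻¹)
    have hd3 : HasFDerivAt F
        (r ^ σ • (fderiv ℝ F u).comp (r⁻¹ • ContinuousLinearMap.id ℝ (Fin n → ℝ))) x := by
      refine hd2.congr_of_eventuallyEq ?_
      filter_upwards [(Uset_open n).mem_nhds hx] with y hy
      have := hhom r hr (r⁻¹ • y) (smul_ne_zero (inv_ne_zero hr.ne') (U_ne_zero hn hy))
      rw [smul_inv_smul₀ hr.ne'] at this
      exact this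
    rw [hd3.fderiv, ContinuousLinearMap.comp_smul, ContinuousLinearMap.comp_id, norm_smul, norm_smul,
      Real.norm_eq_abs, Real.norm_eq_abs, abs_of_pos (rpow_pos_of_pos hr σ), abs_of_pos (inv_pos.2 hr),
      rpow_sub hr, rpow_one]
    have : r ^ σ * (r⁻¹ * ‖fderiv ℝ F u‖) = ‖fderiv ℝ F u‖ * (r ^ σ / r) := by ring
    rw [this]
    exact mul_le_mul_of_nonneg_right hB.2 (by positivity)


lemma absdiff_aux {u v M ξ : ℝ} (hv : 0 < v) (huv : v ≤ u) (hu : u ≤ M) (hξ : 0 ≤ ξ)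
    {m : ℕ} (hm : 1 ≤ m) :
    |u ^ ξ * u ^ m - v ^ ξ * v ^ m| ≤ ((⌈ξ⌉₊ : ℝ) + 1) * M ^ ξ * |u ^ m - v ^ m| := by
  have hu0 : 0 < u := hv.trans_le huv
  have h1 : v ^ m ≤ u ^ m := pow_le_pow_left₀ hv.le huv m
  have h2 : v ^ ξ ≤ u ^ ξ := rpow_le_rpow hv.le huv hξ
  have h3 : v ^ ξ * v ^ m ≤ u ^ ξ * u ^ m := by gcongr
  rw [abs_of_nonneg (by linarith), abs_of_nonneg (by linarith)]
  have h4 : u ^ ξ ≤ M ^ ξ := rpow_le_rpow hu0.le hu hξ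
  set τ := v / u with hτ
  have hτ0 : 0 < τ := by positivity
  have hτ1 : τ ≤ 1 := by rw [hτ, div_le_one hu0]; exact huv
  have hvτ : v = τ * u := by rw [hτ]; field_simp
  have b1 : 1 - τ ^ ξ ≤ ⌈ξ⌉₊ * (1 - τ) := by
    have e1 : τ ^ (⌈ξ⌉₊ : ℝ) ≤ τ ^ ξ := rpow_le_rpow_of_exponent_ge hτ0 hτ1 (Nat.le_ceil ξ)
    rw [rpow_natCast] at e1
    have e2 := one_add_mul_le_pow (a := τ - 1) (by linarith) ⌈ξ⌉₊
    have e3 : 1 + (τ - 1) = τ := by ring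
    rw [e3] at e2
    linarith
  have b2 : τ ^ m ≤ τ := by
    have := pow_le_pow_of_le_one hτ0.le hτ1 hm
    simpa using this
  have b3 : 0 ≤ τ ^ m := by positivity
  have b4 : 0 ≤ 1 - τ ^ ξ := by
    have := rpow_le_one hτ0.le hτ1 hξ; linarith
  have b5 : τ ^ m * (1 - τ ^ ξ) ≤ ⌈ξ⌉₊ * (1 - τ ^ m) := by
    have c1 : τ ^ m * (1 - τ ^ ξ) ≤ 1 * (1 - τ ^ ξ) :=
      mul_le_mul_of_nonneg_right (b2.trans hτ1) b4
    have c2 : (⌈ξ⌉₊ : ℝ) * (1 - τ) ≤ ⌈ξ⌉₊ * (1 - τ ^ m) := by gcongr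
    linarith
  have b6 : u ^ ξ * u ^ m - v ^ ξ * v ^ m ≤ ((⌈ξ⌉₊ : ℝ) + 1) * u ^ ξ * (u ^ m - v ^ m) := by
    have e1 : v ^ ξ = τ ^ ξ * u ^ ξ := by rw [hvτ, mul_rpow hτ0.le hu0.le]
    have e2 : v ^ m = τ ^ m * u ^ m := by rw [hvτ, mul_pow]
    rw [e1, e2]
    have : 0 ≤ u ^ ξ * u ^ m := by positivity
    nlinarith [mul_le_mul_of_nonneg_left b5 this]
  refine b6.trans ?_
  gcongr

lemma absdiff {u v M ξ : ℝ} (hu0 : 0 < u) (hv0 : 0 < v) (hu : u ≤ M) (hv : v ≤ M) (hξ : 0 ≤ ξ)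
    {m : ℕ} (hm : 1 ≤ m) :
    |u ^ ξ * u ^ m - v ^ ξ * v ^ m| ≤ ((⌈ξ⌉₊ : ℝ) + 1) * M ^ ξ * |u ^ m - v ^ m| := by
  rcases le_total v u with h | h
  · exact absdiff_aux hv0 h hu hξ hm
  · rw [abs_sub_comm, abs_sub_comm (u ^ m)]
    exact absdiff_aux hu0 h hv hξ hm

lemma absdiff' {x y M ξ : ℝ} (hx0 : x ≠ 0) (hy0 : y ≠ 0) (hx : |x| ≤ M) (hy : |y| ≤ M) (hξ : 0 ≤ ξ)
    {m : ℕ} (hm : 1 ≤ m) :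
    |(|x| ^ ξ * x ^ m) - (|y| ^ ξ * y ^ m)| ≤ ((⌈ξ⌉₊ : ℝ) + 1) * M ^ ξ * |x ^ m - y ^ m| := by
  have hM : 0 ≤ M := (abs_nonneg x).trans hx
  have same := absdiff (abs_pos.2 hx0) (abs_pos.2 hy0) hx hy hξ hm
  have opp : |x| ^ ξ * |x| ^ m + |y| ^ ξ * |y| ^ m ≤
      ((⌈ξ⌉₊ : ℝ) + 1) * M ^ ξ * (|x| ^ m + |y| ^ m) := by
    have e1 : |x| ^ ξ ≤ M ^ ξ := rpow_le_rpow (abs_nonneg _) hx hξ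
    have e2 : |y| ^ ξ ≤ M ^ ξ := rpow_le_rpow (abs_nonneg _) hy hξ
    have e3 : M ^ ξ ≤ ((⌈ξ⌉₊ : ℝ) + 1) * M ^ ξ := by
      have : 0 ≤ M ^ ξ := by positivity
      have : 0 ≤ (⌈ξ⌉₊ : ℝ) := by positivity
      nlinarith
    have := mul_le_mul_of_nonneg_right (e1.trans e3) (by positivity : 0 ≤ |x| ^ m)
    have := mul_le_mul_of_nonneg_right (e2.trans e3) (by positivity : 0 ≤ |y| ^ m)
    linarith
  have p1 : 0 ≤ |x| ^ ξ * |x| ^ m + |y| ^ ξ * |y| ^ m := by positivity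
  have p2 : 0 ≤ |x| ^ m + |y| ^ m := by positivity
  have hxm : x ^ m = |x| ^ m ∨ x ^ m = -|x| ^ m := by
    rw [← abs_pow]; exact eq_or_eq_neg_of_abs_eq rfl
  have hym : y ^ m = |y| ^ m ∨ y ^ m = -|y| ^ m := by
    rw [← abs_pow]; exact eq_or_eq_neg_of_abs_eq rfl
  rcases hxm with h | h <;> rcases hym with h' | h' <;> rw [h, h']
  · exact same
  · rw [mul_neg, sub_neg_eq_add, sub_neg_eq_add, abs_of_nonneg p1, abs_of_nonneg p2]; exact opp
  · rw [mul_neg, ← neg_add', ← neg_add', abs_neg, abs_neg, abs_of_nonneg p1, abs_of_nonneg p2]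
    exact opp
  · rw [mul_neg, mul_neg, neg_sub_neg, neg_sub_neg, abs_sub_comm, abs_sub_comm (|y| ^ m)]; exact same

lemma pow_ne_of_sq_ne {x y : ℝ} (h : x ^ 2 ≠ y ^ 2) {a : ℕ} (ha : 1 ≤ a) : x ^ a - y ^ a ≠ 0 := by
  intro h'
  have h1 : |x| ^ a = |y| ^ a := by rw [← abs_pow, ← abs_pow, sub_eq_zero.1 h']
  have := (pow_left_inj₀ (abs_nonneg x) (abs_nonneg y) (by omega)).1 h1
  exact h ((sq_eq_sq_iff_abs_eq_abs _ _).2 this)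

lemma sum_symm {n : ℕ} (w X : Fin n → ℝ) :
    (∑ i, ∑ j, if j ≠ i then w i / (X i - X j) else 0) =
      ∑ i, ∑ j, if i < j then (w i - w j) / (X i - X j) else 0 := by
  have h1 : ∀ i j : Fin n, (if j ≠ i then w i / (X i - X j) else 0)
      = (if i < j then w i / (X i - X j) else 0) + (if j < i then w i / (X i - X j) else 0) := by
    intro i j
    rcases lt_trichotomy i j with h | h | h
    · simp [h, h.not_gt, h.ne']
    · simp [h]
    · simp [h, h.not_gt, h.ne]
  have h2 : ∀ i j : Fin n, (if i < j then (w i - w j) / (X i - X j) else 0)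
      = (if i < j then w i / (X i - X j) else 0) + (if i < j then w j / (X j - X i) else 0) := by
    intro i j
    split_ifs with h
    · rw [sub_div, ← neg_sub (X i) (X j), div_neg]; ring
    · simp
  simp only [h1, h2, Finset.sum_add_distrib]
  congr 1
  rw [Finset.sum_comm]

/-- the radial-type vector field -/
noncomputable def Wf {n : ℕ} (ξ : ℝ) (x : Fin n → ℝ) : Fin n → ℝ := fun i => |x i| ^ ξ * x i

/-- logarithmic derivative sum -/
noncomputable def Hf {n : ℕ} (a : ℕ) (ξ : ℝ) (x : Fin n → ℝ) : ℝ :=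
  ∑ i, ∑ j, if i < j then (|x i| ^ ξ * x i ^ a - |x j| ^ ξ * x j ^ a) / (x i ^ a - x j ^ a) else 0

lemma Hf_bound {n : ℕ} {a : ℕ} (ha : 1 ≤ a) {ξ : ℝ} (hξ : 0 ≤ ξ) {x : Fin n → ℝ} (hx : x ∈ Uset n) :
    |Hf a ξ x| ≤ (n * (n * ((⌈ξ⌉₊ : ℝ) + 1))) * ‖x‖ ^ ξ := by
  have h1 : ∀ i j : Fin n, |if i < j then
      (|x i| ^ ξ * x i ^ a - |x j| ^ ξ * x j ^ a) / (x i ^ a - x j ^ a) else 0|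
      ≤ ((⌈ξ⌉₊ : ℝ) + 1) * ‖x‖ ^ ξ := by
    intro i j
    split_ifs with h
    · rw [abs_div, div_le_iff₀ (abs_pos.2 (pow_ne_of_sq_ne (hx.2 i j h.ne) ha))]
      exact absdiff' (hx.1 i) (hx.1 j) (norm_le_pi_norm x i) (norm_le_pi_norm x j) hξ ha
    · simp; positivity
  unfold Hf
  calc _ ≤ ∑ i : Fin n, ∑ j : Fin n, ((⌈ξ⌉₊ : ℝ) + 1) * ‖x‖ ^ ξ :=
        (Finset.abs_sum_le_sum_abs _ _).trans (Finset.sum_le_sum fun i _ =>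
          (Finset.abs_sum_le_sum_abs _ _).trans (Finset.sum_le_sum fun j _ => h1 i j))
    _ = _ := by simp; ring

lemma cont_abs_rpow {n : ℕ} {q : ℝ} (hq : 0 ≤ q) (i : Fin n) :
    Continuous fun x : Fin n → ℝ => |x i| ^ q :=
  Continuous.rpow_const (by fun_prop) fun x => Or.inr hq

lemma Hf_cont {n : ℕ} {a : ℕ} (ha : 1 ≤ a) {ξ : ℝ} (hξ : 0 ≤ ξ) :
    ContinuousOn (Hf (n := n) a ξ) (Uset n) := by
  unfold Hf
  refine continuousOn_finsetSum _ fun i _ => continuousOn_finsetSum _ fun j _ => ?_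
  split_ifs with h
  · refine ContinuousOn.div ?_ (by fun_prop) fun x hx => pow_ne_of_sq_ne (hx.2 i j h.ne) ha
    have := cont_abs_rpow (n := n) hξ i
    have := cont_abs_rpow (n := n) hξ j
    fun_prop
  · exact continuousOn_const

lemma Wf_cont {n : ℕ} {ξ : ℝ} (hξ : 0 ≤ ξ) : Continuous (Wf (n := n) ξ) := by
  refine continuous_pi fun i => ?_
  have := cont_abs_rpow (n := n) hξ i
  unfold Wf
  fun_prop

lemma Wf_bound {n : ℕ} (hn : 1 ≤ n) {ξ : ℝ} (hξ : 0 ≤ ξ) {x : Fin n → ℝ} (hx : x ∈ Uset n) :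
    ‖Wf ξ x‖ ≤ ‖x‖ ^ (ξ + 1) := by
  have h0 : 0 < ‖x‖ := norm_pos_iff.2 (U_ne_zero hn hx)
  refine (pi_norm_le_iff_of_nonneg (by positivity)).2 fun i => ?_
  rw [rpow_add_one h0.ne']
  unfold Wf
  have h1 := norm_le_pi_norm x i
  rw [Real.norm_eq_abs] at h1
  rw [norm_mul, Real.norm_eq_abs, Real.norm_eq_abs, abs_of_nonneg (by positivity : 0 ≤ |x i| ^ ξ)]
  exact mul_le_mul (rpow_le_rpow (abs_nonneg _) h1 hξ) h1 (abs_nonneg _) (by positivity)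

lemma sum_rpow_bound {n : ℕ} {q : ℝ} (hq : 0 ≤ q) (x : Fin n → ℝ) :
    |∑ i, |x i| ^ q| ≤ n * ‖x‖ ^ q := by
  rw [abs_of_nonneg (Finset.sum_nonneg fun i _ => by positivity)]
  calc _ ≤ ∑ i : Fin n, ‖x‖ ^ q := Finset.sum_le_sum fun i _ =>
        rpow_le_rpow (abs_nonneg _) (norm_le_pi_norm x i) hq
    _ = _ := by simp

/-- Logarithmic derivative -/
def LD {E : Type*} [NormedAddCommGroup E] [NormedSpace ℝ E] (φ : E → ℝ) (L : E →L[ℝ] ℝ) (x : E) :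
    Prop := HasFDerivAt φ (φ x • L) x

section LDsec
variable {E : Type*} [NormedAddCommGroup E] [NormedSpace ℝ E]

lemma LD.mul {φ ψ : E → ℝ} {L L' : E →L[ℝ] ℝ} {x : E} (h : LD φ L x) (h' : LD ψ L' x) :
    LD (fun y => φ y * ψ y) (L + L') x := by
  unfold LD at *
  convert! HasFDerivAt.mul h h' using 1
  ext v; simp; ring

lemma LD.one {x : E} : LD (fun _ => 1) 0 x := by
  unfold LD
  simpa using hasFDerivAt_const (1:ℝ) x

lemma LD.prod {ι : Type*} [Fintype ι] {φ : ι → E → ℝ} {L : ι → E →L[ℝ] ℝ} {x : E}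
    (h : ∀ i, LD (φ i) (L i) x) : LD (fun y => ∏ i, φ i y) (∑ i, L i) x := by
  classical
  have : ∀ s : Finset ι, LD (fun y => ∏ i ∈ s, φ i y) (∑ i ∈ s, L i) x := by
    intro s
    induction s using Finset.induction_on with
    | empty => simpa using LD.one
    | insert a s ha ih =>
      simp only [Finset.prod_insert ha, Finset.sum_insert ha]
      exact (h a).mul ih
  exact this _

lemma LD.abs_pow {h : E → ℝ} {h' : E →L[ℝ] ℝ} {x : E} (hd : HasFDerivAt h h' x) (h0 : h x ≠ 0) (m : ℕ) :
    LD (fun y => |h y| ^ m) ((m / h x) • h') x := by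
  have base : LD (fun y => |h y|) ((h x)⁻¹ • h') x := by
    unfold LD
    convert! hd.abs h0 using 1
    rw [smul_smul]
    congr 1
    rcases lt_or_gt_of_ne h0 with hh | hh
    · simp [hh, abs_of_neg hh, h0]
    · simp [hh, abs_of_pos hh, h0]
  have := LD.prod (ι := Fin m) (fun _ => base)
  convert this using 1
  · simp
  · simp [div_eq_mul_inv, ← Nat.cast_smul_eq_nsmul ℝ, smul_smul]

end LDsec

lemma fabc_LD {n a b c : ℕ} (ha : 1 ≤ a) {x : Fin n → ℝ} (hx : x ∈ Uset n) (ξ : ℝ) :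
    ∃ L : (Fin n → ℝ) →L[ℝ] ℝ, HasFDerivAt (fabc n a b c) (fabc n a b c x • L) x ∧
      L (Wf ξ x) = a * b * Hf a ξ x + c * ∑ i, |x i| ^ ξ := by
  have hp : ∀ (i : Fin n) (m : ℕ), HasFDerivAt (fun y : Fin n → ℝ => y i ^ m)
      ((m * x i ^ (m - 1)) • ContinuousLinearMap.proj (R := ℝ) (φ := fun _ : Fin n => ℝ) i) x := by
    intro i m
    have := (ContinuousLinearMap.proj (R := ℝ) (φ := fun _ : Fin n => ℝ) i).hasFDerivAt (x := x)
    simpa using this.pow m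
  let L1 : Fin n → Fin n → ((Fin n → ℝ) →L[ℝ] ℝ) := fun i j => if i < j then
    (b / (x i ^ a - x j ^ a)) •
      ((a * x i ^ (a - 1)) • ContinuousLinearMap.proj (R := ℝ) (φ := fun _ : Fin n => ℝ) i
      - (a * x j ^ (a - 1)) • ContinuousLinearMap.proj (R := ℝ) (φ := fun _ : Fin n => ℝ) j) else 0
  let L2 : Fin n → ((Fin n → ℝ) →L[ℝ] ℝ) := fun i =>
    (c / x i) • ContinuousLinearMap.proj (R := ℝ) (φ := fun _ : Fin n => ℝ) i
  refine ⟨∑ i, ∑ j, L1 i j + ∑ i, L2 i, ?_, ?_⟩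
  · have h1 : ∀ i j, LD (fun y : Fin n → ℝ => if i < j then |y i ^ a - y j ^ a| ^ b else 1) (L1 i j) x := by
      intro i j
      by_cases h : i < j
      · simp only [h, if_true, L1]
        exact LD.abs_pow (h := fun y : Fin n → ℝ => y i ^ a - y j ^ a)
          ((hp i a).sub (hp j a)) (pow_ne_of_sq_ne (hx.2 i j h.ne) ha) b
      · simp only [h, if_false, L1]
        exact LD.one
    have h2 : ∀ i, LD (fun y : Fin n → ℝ => |y i| ^ c) (L2 i) x := by
      intro i
      exact LD.abs_pow (h := fun y : Fin n → ℝ => y i)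
        (ContinuousLinearMap.proj (R := ℝ) (φ := fun _ : Fin n => ℝ) i).hasFDerivAt (hx.1 i) c
    exact (LD.prod fun i => LD.prod fun j => h1 i j).mul (LD.prod h2)
  · simp only [ContinuousLinearMap.add_apply, ContinuousLinearMap.sum_apply]
    congr 1
    · unfold Hf
      simp only [Finset.mul_sum]
      refine Finset.sum_congr rfl fun i _ => Finset.sum_congr rfl fun j _ => ?_
      simp only [L1]
      split_ifs with h
      · have e : ∀ t : ℝ, t ^ a = t ^ (a - 1) * t := fun t => by
          rw [← pow_succ]; congr 1; omega
        simp only [ContinuousLinearMap.smul_apply, ContinuousLinearMap.sub_apply,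
          ContinuousLinearMap.proj_apply, smul_eq_mul, Wf]
        rw [show |x i| ^ ξ * x i ^ a = |x i| ^ ξ * (x i ^ (a-1) * x i) by rw [← e],
          show |x j| ^ ξ * x j ^ a = |x j| ^ ξ * (x j ^ (a-1) * x j) by rw [← e]]
        ring
      · simp
    · rw [Finset.mul_sum]
      refine Finset.sum_congr rfl fun i _ => ?_
      have := hx.1 i
      simp only [L2, ContinuousLinearMap.smul_apply, ContinuousLinearMap.proj_apply, smul_eq_mul, Wf]
      field_simp

lemma fabc_ne {n a b c : ℕ} (ha : 1 ≤ a) {x : Fin n → ℝ} (hx : x ∈ Uset n) : fabc n a b c x ≠ 0 := by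
  unfold fabc
  refine mul_ne_zero (Finset.prod_ne_zero_iff.2 fun i _ => Finset.prod_ne_zero_iff.2 fun j _ => ?_)
    (Finset.prod_ne_zero_iff.2 fun i _ => pow_ne_zero _ (abs_ne_zero.2 (hx.1 i)))
  split_ifs with h
  · exact pow_ne_zero _ (abs_ne_zero.2 (pow_ne_of_sq_ne (hx.2 i j h.ne) ha))
  · exact one_ne_zero


/-- derivative bounded by a multiple of the function -/
def BD {E : Type*} [NormedAddCommGroup E] [NormedSpace ℝ E] (φ : E → ℝ) (x w : E) (B : ℝ) : Prop :=
  ∃ φ' : E →L[ℝ] ℝ, HasFDerivAt φ φ' x ∧ |φ' w| ≤ B * φ x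

section BDsec
variable {E : Type*} [NormedAddCommGroup E] [NormedSpace ℝ E]

lemma BD.add {φ ψ : E → ℝ} {x w : E} {B : ℝ} (h : BD φ x w B) (h' : BD ψ x w B) :
    BD (fun y => φ y + ψ y) x w B := by
  obtain ⟨p, hp, hp'⟩ := h
  obtain ⟨q, hq, hq'⟩ := h'
  refine ⟨p + q, hp.add hq, ?_⟩
  have := abs_add_le (p w) (q w)
  change |p w + q w| ≤ _
  linarith

lemma BD.zero {x w : E} {B : ℝ} : BD (fun _ => 0) x w B :=
  ⟨0, hasFDerivAt_const _ _, by simp⟩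

lemma BD.sum {ι : Type*} [Fintype ι] {φ : ι → E → ℝ} {x w : E} {B : ℝ}
    (h : ∀ i, BD (φ i) x w B) : BD (fun y => ∑ i, φ i y) x w B := by
  classical
  have : ∀ s : Finset ι, BD (fun y => ∑ i ∈ s, φ i y) x w B := by
    intro s
    induction s using Finset.induction_on with
    | empty => simpa using BD.zero
    | insert a s ha ih =>
      simp only [Finset.sum_insert ha]
      exact (h a).add ih
  exact this _

lemma BD.inv {φ : E → ℝ} {x w : E} {B : ℝ} (h : BD φ x w B) (h0 : 0 < φ x) :
    BD (fun y => (φ y)⁻¹) x w B := by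
  obtain ⟨p, hp, hp'⟩ := h
  refine ⟨_, (hasDerivAt_inv h0.ne').comp_hasFDerivAt x hp, ?_⟩
  simp only [smul_apply, smul_eq_mul]
  rw [abs_mul, abs_neg, abs_of_pos (by positivity)]
  calc _ ≤ (φ x ^ 2)⁻¹ * (B * φ x) := by gcongr
    _ = _ := by field_simp

lemma BD.mono {φ : E → ℝ} {x w : E} {B B' : ℝ} (h : BD φ x w B) (h0 : 0 ≤ φ x) (hB : B ≤ B') :
    BD φ x w B' := by
  obtain ⟨p, hp, hp'⟩ := h
  exact ⟨p, hp, hp'.trans (mul_le_mul_of_nonneg_right hB h0)⟩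
end BDsec

/-- exhaustion function -/
noncomputable def Phi {n : ℕ} (x : Fin n → ℝ) : ℝ :=
  (∑ i, (x i ^ 2 + (x i ^ 2)⁻¹)) + ∑ i, ∑ j, if i < j then ((x i ^ 2 - x j ^ 2) ^ 2)⁻¹ else 0

lemma Phi_nonneg {n : ℕ} (x : Fin n → ℝ) : 0 ≤ Phi x := by
  unfold Phi
  refine add_nonneg (Finset.sum_nonneg fun i _ => by positivity)
    (Finset.sum_nonneg fun i _ => Finset.sum_nonneg fun j _ => ?_)
  split_ifs <;> positivity

lemma Phi_contDiffOn (n : ℕ) : ContDiffOn ℝ 1 (Phi (n := n)) (Uset n) := by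
  unfold Phi
  refine ContDiffOn.add (ContDiffOn.sum fun i _ => ContDiffOn.add (by fun_prop) (ContDiffOn.inv (by fun_prop) fun x hx => pow_ne_zero _ (hx.1 i)))
    (ContDiffOn.sum fun i _ => ContDiffOn.sum fun j _ => ?_)
  split_ifs with h
  · exact ContDiffOn.inv (by fun_prop) fun x hx => pow_ne_zero _ (sub_ne_zero.2 (hx.2 i j h.ne))
  · exact contDiffOn_const

lemma Phi_BD {n : ℕ} {ξ : ℝ} (hξ : 0 ≤ ξ) {x : Fin n → ℝ} (hx : x ∈ Uset n) :
    BD Phi x (Wf ξ x) (4 * ((⌈ξ⌉₊ : ℝ) + 1) * ‖x‖ ^ ξ) := by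
  have hp : ∀ (i : Fin n), HasFDerivAt (fun y : Fin n → ℝ => y i ^ 2)
      ((2 * x i) • ContinuousLinearMap.proj (R := ℝ) (φ := fun _ : Fin n => ℝ) i) x := by
    intro i
    have := (ContinuousLinearMap.proj (R := ℝ) (φ := fun _ : Fin n => ℝ) i).hasFDerivAt (x := x)
    simpa using this.pow 2
  have hk : (0:ℝ) ≤ ⌈ξ⌉₊ := by positivity
  have h1 : ∀ i, BD (fun y : Fin n → ℝ => y i ^ 2) x (Wf ξ x) (4 * ((⌈ξ⌉₊ : ℝ) + 1) * ‖x‖ ^ ξ) := by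
    intro i
    refine ⟨_, hp i, ?_⟩
    simp only [smul_apply, ContinuousLinearMap.proj_apply, smul_eq_mul, Wf]
    have e1 : |x i| ^ ξ ≤ ‖x‖ ^ ξ := rpow_le_rpow (abs_nonneg _) (norm_le_pi_norm x i) hξ
    have e2 : 2 * x i * (|x i| ^ ξ * x i) = 2 * |x i| ^ ξ * x i ^ 2 := by ring
    rw [e2, abs_of_nonneg (by positivity)]
    gcongr
    have : 0 ≤ ‖x‖ ^ ξ := by positivity
    nlinarith
  have h2 : ∀ i j, i < j → BD (fun y : Fin n → ℝ => (y i ^ 2 - y j ^ 2) ^ 2) x (Wf ξ x)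
      (4 * ((⌈ξ⌉₊ : ℝ) + 1) * ‖x‖ ^ ξ) := by
    intro i j hij
    refine ⟨_, ((hp i).sub (hp j)).pow 2, ?_⟩
    simp only [smul_apply, sub_apply, ContinuousLinearMap.proj_apply, smul_eq_mul, Wf]
    have := absdiff' (hx.1 i) (hx.1 j) (norm_le_pi_norm x i) (norm_le_pi_norm x j) hξ (m := 2) (by norm_num)
    have e : ((2 : ℕ) * (x i ^ 2 - x j ^ 2) ^ (2 - 1)) *
      (2 * x i * (|x i| ^ ξ * x i) - 2 * x j * (|x j| ^ ξ * x j))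
      = 4 * (x i ^ 2 - x j ^ 2) * (|x i| ^ ξ * x i ^ 2 - |x j| ^ ξ * x j ^ 2) := by
      push_cast; ring
    simp only [nsmul_eq_mul, Pi.sub_apply] at *
    rw [e, abs_mul, abs_mul, abs_of_pos (by norm_num : (0:ℝ) < 4), ← sq_abs (x i ^ 2 - x j ^ 2)]
    have h0 := abs_nonneg (x i ^ 2 - x j ^ 2)
    nlinarith [mul_le_mul_of_nonneg_left this h0]
  unfold Phi
  refine BD.add (BD.sum fun i => (h1 i).add ((h1 i).inv ?_)) (BD.sum fun i => BD.sum fun j => ?_)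
  · have := hx.1 i; positivity
  · by_cases h : i < j
    · simp only [h, if_true]
      refine (h2 i j h).inv ?_
      have := sub_ne_zero.2 (hx.2 i j h.ne)
      positivity
    · simp only [h, if_false]
      exact BD.zero

lemma Phi_bound {n : ℕ} {ξ : ℝ} (hξ : 0 ≤ ξ) {x : Fin n → ℝ} (hx : x ∈ Uset n) :
    |fderiv ℝ Phi x (Wf ξ x)| ≤ (4 * ((⌈ξ⌉₊ : ℝ) + 1) * ‖x‖ ^ ξ) * Phi x := by
  obtain ⟨p, hp, hp'⟩ := Phi_BD hξ hx
  rwa [hp.fderiv]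

/-- compact sets -/
def Kset (n : ℕ) (R : ℝ) : Set (Fin n → ℝ) :=
  {x | (∀ i, x i ^ 2 ≤ R) ∧ (∀ i, 1 ≤ R * x i ^ 2) ∧ ∀ i j, i < j → 1 ≤ R * (x i ^ 2 - x j ^ 2) ^ 2}

lemma Kset_sub (n : ℕ) (R : ℝ) : Kset n R ⊆ Uset n := by
  rintro x ⟨h1, h2, h3⟩
  refine ⟨fun i h => ?_, fun i j hij h => ?_⟩
  · have := h2 i; rw [h] at this; norm_num at this
  · rcases lt_or_gt_of_ne hij with h' | h'
    · have := h3 i j h'; rw [h] at this; norm_num at this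
    · have := h3 j i h'; rw [h] at this; norm_num at this

lemma Kset_compact (n : ℕ) (R : ℝ) : IsCompact (Kset n R) := by
  refine Metric.isCompact_of_isClosed_isBounded ?_ ?_
  · have : Kset n R = (⋂ i, {x : Fin n → ℝ | x i ^ 2 ≤ R}) ∩ ((⋂ i, {x : Fin n → ℝ | 1 ≤ R * x i ^ 2}) ∩
      ⋂ i, ⋂ j, {x : Fin n → ℝ | i < j → 1 ≤ R * (x i ^ 2 - x j ^ 2) ^ 2}) := by
      ext x; simp [Kset]
    rw [this]
    refine IsClosed.inter (isClosed_iInter fun i => isClosed_le (by fun_prop) (by fun_prop))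
      (IsClosed.inter (isClosed_iInter fun i => isClosed_le (by fun_prop) (by fun_prop))
       (isClosed_iInter fun i => isClosed_iInter fun j => ?_))
    by_cases h : i < j
    · simp only [h, forall_const]
      exact isClosed_le (by fun_prop) (by fun_prop)
    · simp [h]
  · refine (Metric.isBounded_closedBall (x := (0 : Fin n → ℝ)) (r := √R)).subset ?_
    intro x hx
    rw [mem_closedBall_zero_iff]
    exact (pi_norm_le_iff_of_nonneg (sqrt_nonneg _)).2 fun i => abs_le_sqrt (hx.1 i)

lemma mem_Kset {n : ℕ} {R : ℝ} {x : Fin n → ℝ} (hx : x ∈ Uset n) (h : Phi x ≤ R) : x ∈ Kset n R := by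
  have n1 : ∀ i, 0 ≤ x i ^ 2 + (x i ^ 2)⁻¹ := fun i => by positivity
  have n2 : ∀ i j, 0 ≤ (if i < j then ((x i ^ 2 - x j ^ 2) ^ 2)⁻¹ else 0) := fun i j => by
    split_ifs <;> positivity
  have a1 : ∀ i, x i ^ 2 + (x i ^ 2)⁻¹ ≤ R := fun i => by
    have := Finset.single_le_sum (f := fun i => x i ^ 2 + (x i ^ 2)⁻¹) (fun i _ => n1 i) (Finset.mem_univ i)
    have : 0 ≤ ∑ i, ∑ j, if i < j then ((x i ^ 2 - x j ^ 2) ^ 2)⁻¹ else 0 :=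
      Finset.sum_nonneg fun i _ => Finset.sum_nonneg fun j _ => n2 i j
    unfold Phi at h
    linarith
  have a2 : ∀ i j, i < j → ((x i ^ 2 - x j ^ 2) ^ 2)⁻¹ ≤ R := fun i j hij => by
    have e1 := Finset.single_le_sum (f := fun j => if i < j then ((x i ^ 2 - x j ^ 2) ^ 2)⁻¹ else 0) (fun j _ => n2 i j) (Finset.mem_univ j)
    have e2 := Finset.single_le_sum (f := fun i => ∑ j, if i < j then ((x i ^ 2 - x j ^ 2) ^ 2)⁻¹ else 0)
      (fun i _ => Finset.sum_nonneg fun j _ => n2 i j) (Finset.mem_univ i)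
    have : 0 ≤ ∑ i, (x i ^ 2 + (x i ^ 2)⁻¹) := Finset.sum_nonneg fun i _ => n1 i
    unfold Phi at h
    simp only [hij, if_true] at e1
    linarith
  refine ⟨fun i => ?_, fun i => ?_, fun i j hij => ?_⟩
  · have := a1 i
    have : 0 ≤ (x i ^ 2)⁻¹ := by positivity
    linarith
  · have := a1 i
    have h0 := hx.1 i
    have h1 : 0 < x i ^ 2 := by positivity
    have : (x i ^ 2)⁻¹ ≤ R := by linarith
    rwa [inv_le_iff_one_le_mul₀ h1] at this
  · have h0 := sub_ne_zero.2 (hx.2 i j hij.ne)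
    have h1 : 0 < (x i ^ 2 - x j ^ 2) ^ 2 := by positivity
    have := a2 i j hij
    rwa [inv_le_iff_one_le_mul₀ h1] at this

/-- one-variable cutoff -/
noncomputable def kap (t : ℝ) : ℝ := Real.smoothTransition (2 - t)

lemma kap_contDiff : ContDiff ℝ 1 kap := by
  unfold kap
  exact Real.smoothTransition.contDiff.comp (by fun_prop)

lemma kap_one {t : ℝ} (h : t ≤ 1) : kap t = 1 := Real.smoothTransition.one_of_one_le (by linarith)
lemma kap_zero {t : ℝ} (h : 2 ≤ t) : kap t = 0 := Real.smoothTransition.zero_of_nonpos (by linarith)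
lemma kap_abs (t : ℝ) : |kap t| ≤ 1 := by
  unfold kap
  rw [abs_of_nonneg (Real.smoothTransition.nonneg _)]; exact Real.smoothTransition.le_one _

lemma kap_deriv_zero {t : ℝ} (h : t < 1) : deriv kap t = 0 := by
  have : kap =ᶠ[nhds t] fun _ => 1 := by
    filter_upwards [Iio_mem_nhds h] with y hy using kap_one (le_of_lt hy)
  rw [this.deriv_eq]; simp

lemma kap_deriv_bound : ∃ C : ℝ, 0 ≤ C ∧ ∀ t, 0 ≤ t → |deriv kap t| * t ≤ C := by
  have hc : Continuous (deriv kap) := kap_contDiff.continuous_deriv le_rfl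
  obtain ⟨C, hC⟩ := (isCompact_Icc (a := (0:ℝ)) (b := 2)).exists_bound_of_continuousOn hc.continuousOn
  have hC0 : 0 ≤ C := (norm_nonneg _).trans (hC 0 (by simp))
  refine ⟨C * 2, by positivity, fun t ht => ?_⟩
  by_cases h : t ≤ 2
  · have := hC t ⟨ht, h⟩
    rw [Real.norm_eq_abs] at this
    gcongr
  · have : kap =ᶠ[nhds t] fun _ => 0 := by
      filter_upwards [Ioi_mem_nhds (not_le.1 h)] with y hy using kap_zero (le_of_lt hy)
    rw [this.deriv_eq]; simp; exact hC0

lemma hasDerivAt_abs_rpow' {t : ℝ} (ht : t ≠ 0) (q : ℝ) :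
    HasDerivAt (fun t : ℝ => |t| ^ q) (q * |t| ^ q / t) t := by
  have h := (hasDerivAt_abs ht).rpow_const (p := q) (Or.inl (abs_ne_zero.2 ht))
  convert! h using 1
  rw [rpow_sub_one (abs_ne_zero.2 ht)]
  rcases lt_or_gt_of_ne ht with hh | hh
  · simp [hh, abs_of_neg hh]; field_simp
  · simp [hh, abs_of_pos hh]; field_simp

lemma contDiffOn_abs_rpow {n : ℕ} (q : ℝ) (i : Fin n) :
    ContDiffOn ℝ 1 (fun x : Fin n → ℝ => |x i| ^ q) (Uset n) := by
  intro x hx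
  apply ContDiffAt.contDiffWithinAt
  refine ContDiffAt.rpow_const_of_ne ?_ (abs_ne_zero.2 (hx.1 i))
  exact (contDiffAt_abs (hx.1 i)).comp x (f := fun x : Fin n → ℝ => x i) (by fun_prop)

/-- exponential weight -/
noncomputable def Ef {n : ℕ} (p : ℝ) (x : Fin n → ℝ) : ℝ := Real.exp (-∑ i, |x i| ^ p)

lemma Ef_contDiffOn (n : ℕ) (p : ℝ) : ContDiffOn ℝ 1 (Ef (n := n) p) (Uset n) := by
  unfold Ef
  exact (ContDiffOn.sum fun i _ => contDiffOn_abs_rpow p i).neg.exp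

lemma Ef_fderiv {n : ℕ} (p ξ : ℝ) {x : Fin n → ℝ} (hx : x ∈ Uset n) :
    fderiv ℝ (Ef p) x (Wf ξ x) = -p * (∑ i, |x i| ^ (ξ + p)) * Ef p x := by
  have h1 : ∀ i, HasFDerivAt (fun y : Fin n → ℝ => |y i| ^ p)
    ((p * |x i| ^ p / x i) • ContinuousLinearMap.proj (R := ℝ) (φ := fun _ : Fin n => ℝ) i) x := by
    intro i
    exact (hasDerivAt_abs_rpow' (hx.1 i) p).comp_hasFDerivAt (f := fun y : Fin n → ℝ => y i) x
      (ContinuousLinearMap.proj (R := ℝ) (φ := fun _ : Fin n => ℝ) i).hasFDerivAt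
  have h2 := (HasFDerivAt.fun_sum fun i (_ : i ∈ Finset.univ) => h1 i).neg.exp
  have h3 : HasFDerivAt (Ef p) _ x := h2
  rw [h3.fderiv]
  simp only [Pi.neg_apply, smul_apply, neg_apply, sum_apply, ContinuousLinearMap.proj_apply, smul_eq_mul, Wf]
  have : ∀ i, p * |x i| ^ p / x i * (|x i| ^ ξ * x i) = p * |x i| ^ (ξ + p) := by
    intro i
    have := hx.1 i
    rw [rpow_add (abs_pos.2 this)]; field_simp
  simp only [this, ← Finset.mul_sum]
  unfold Ef
  ring

lemma Wfi_deriv {n : ℕ} (ξ : ℝ) {x : Fin n → ℝ} (hx : x ∈ Uset n) (i : Fin n) :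
    fderiv ℝ (fun y : Fin n → ℝ => |y i| ^ ξ * y i) x (Pi.single i 1) = (ξ + 1) * |x i| ^ ξ := by
  have hd : HasDerivAt (fun t : ℝ => |t| ^ ξ * t) _ (x i) :=
    (hasDerivAt_abs_rpow' (hx.1 i) ξ).mul (hasDerivAt_id _)
  have h : HasFDerivAt (fun y : Fin n → ℝ => |y i| ^ ξ * y i) _ x :=
    hd.comp_hasFDerivAt (f := fun y : Fin n → ℝ => y i) x
      (ContinuousLinearMap.proj (R := ℝ) (φ := fun _ : Fin n => ℝ) i).hasFDerivAt
  rw [h.fderiv]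
  have := hx.1 i
  simp
  field_simp


open Filter Topology

lemma lin_sum {n : ℕ} (L : (Fin n → ℝ) →L[ℝ] ℝ) (w : Fin n → ℝ) :
    ∑ i, w i * L (Pi.single i 1) = L w := by
  conv_rhs => rw [← Finset.univ_sum_single w]
  rw [map_sum]
  refine Finset.sum_congr rfl fun i _ => ?_
  have : Pi.single i (w i) = w i • (Pi.single i (1:ℝ) : Fin n → ℝ) := by
    ext j; by_cases h : j = i
    · subst h; simp
    · simp [h]
  rw [this, map_smul, smul_eq_mul]

/-- divergence identity with compactly supported cutoff -/
lemma div_zero_cut {n : ℕ} (ξ : ℝ) (Q : (Fin n → ℝ) → ℝ)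
    (hQ : ContDiffOn ℝ 1 Q (Uset n)) (K : Set (Fin n → ℝ)) (hK : IsCompact K) (hKU : K ⊆ Uset n)
    (h0 : ∀ x ∈ Uset n, x ∉ K → Q x = 0) :
    ∫ x, (fderiv ℝ Q x (Wf ξ x) + (ξ + 1) * (∑ i, |x i| ^ ξ) * Q x) = 0 := by
  classical
  let G : Fin n → (Fin n → ℝ) → ℝ := fun i => (Uset n).indicator fun x => Q x * (|x i| ^ ξ * x i)
  have hwi : ∀ i, ContDiffOn ℝ 1 (fun x : Fin n → ℝ => |x i| ^ ξ * x i) (Uset n) := fun i =>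
    (contDiffOn_abs_rpow ξ i).mul (by fun_prop)
  have hG : ∀ i, ContDiffOn ℝ 1 (G i) (Uset n) := fun i =>
    (hQ.mul (hwi i)).congr fun x hx => Set.indicator_of_mem hx _
  have hG0 : ∀ i, ∀ x ∉ K, G i x = 0 := by
    intro i x hx
    by_cases hxU : x ∈ Uset n
    · simp only [G, Set.indicator_of_mem hxU, h0 x hxU hx, zero_mul]
    · exact Set.indicator_of_notMem hxU _
  have hI := fun i => ibp_compact (Uset n) K (Uset_open n) hK hKU (G i) (hG i) (Pi.single i 1) (hG0 i)
  have hsum : ∫ x, ∑ i, fderiv ℝ (G i) x (Pi.single i 1) = 0 := by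
    rw [integral_finsetSum _ fun i _ => (hI i).1]
    exact Finset.sum_eq_zero fun i _ => (hI i).2
  rw [← hsum]
  refine integral_congr_ae ?_
  filter_upwards [Uset_ae n] with x hx
  have hnh := (Uset_open n).mem_nhds hx
  have hQd : DifferentiableAt ℝ Q x := (hQ.contDiffAt hnh).differentiableAt one_ne_zero
  have hd : ∀ i, fderiv ℝ (G i) x (Pi.single i 1) =
      Q x * ((ξ + 1) * |x i| ^ ξ) + (|x i| ^ ξ * x i) * fderiv ℝ Q x (Pi.single i 1) := by
    intro i
    have e1 : G i =ᶠ[𝓝 x] fun x => Q x * (|x i| ^ ξ * x i) := by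
      filter_upwards [hnh] with y hy using Set.indicator_of_mem hy _
    rw [e1.fderiv_eq, fderiv_fun_mul hQd (((hwi i).contDiffAt hnh).differentiableAt one_ne_zero)]
    simp only [add_apply, smul_apply, smul_eq_mul]
    rw [Wfi_deriv ξ hx i]
  simp only [hd, Finset.sum_add_distrib]
  have := lin_sum (fderiv ℝ Q x) (Wf ξ x)
  simp only [Wf] at this ⊢
  rw [this, ← Finset.mul_sum, ← Finset.mul_sum]
  ring

lemma main_identity {n : ℕ} (hn : 1 ≤ n) {p ξ σ : ℝ} (hp : 1 ≤ p) (hξ : 0 ≤ ξ)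
    (hσ : -(n : ℝ) < σ + ξ) {F : (Fin n → ℝ) → ℝ} (h : HC1 F)
    (hhom : ∀ r : ℝ, 0 < r → ∀ x : Fin n → ℝ, x ≠ 0 → F (r • x) = r ^ σ * F x) :
    Integrable (fun x => fderiv ℝ F x (Wf ξ x) * Ef p x) ∧
    Integrable (fun x => F x * (∑ i, |x i| ^ ξ) * Ef p x) ∧
    Integrable (fun x => F x * (∑ i, |x i| ^ (ξ + p)) * Ef p x) ∧
    (∀ a : ℕ, 1 ≤ a → Integrable (fun x => F x * Hf a ξ x * Ef p x)) ∧
    ∫ x, (fderiv ℝ F x (Wf ξ x) * Ef p x + (ξ + 1) * (F x * (∑ i, |x i| ^ ξ) * Ef p x)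
      - p * (F x * (∑ i, |x i| ^ (ξ + p)) * Ef p x)) = 0 := by
  obtain ⟨C, hC0, hC⟩ := F_bound hn h σ hhom
  have hF := contDiffOn_F hn h
  have hF' : ContinuousOn (fun x => fderiv ℝ F x (Wf ξ x)) (Uset n) :=
    (hF.continuousOn_fderiv_of_isOpen (Uset_open n) le_rfl).clm_apply (Wf_cont hξ).continuousOn
  have hpos : ∀ x ∈ Uset n, 0 < ‖x‖ := fun x hx => norm_pos_iff.2 (U_ne_zero hn hx)
  have cs : ∀ q : ℝ, 0 ≤ q → Continuous fun x : Fin n → ℝ => ∑ i, |x i| ^ q := fun q hq =>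
    continuous_finsetSum _ fun i _ => cont_abs_rpow hq i
  have i1 : Integrable (fun x => fderiv ℝ F x (Wf ξ x) * Ef p x) := by
    refine integrable_of_bound hn p (σ + ξ) hp hσ _ hF' C fun x hx => ?_
    have := hpos x hx
    calc |fderiv ℝ F x (Wf ξ x)| ≤ ‖fderiv ℝ F x‖ * ‖Wf ξ x‖ := (fderiv ℝ F x).le_opNorm _
      _ ≤ (C * ‖x‖ ^ (σ - 1)) * ‖x‖ ^ (ξ + 1) :=
        mul_le_mul (hC x hx).2 (Wf_bound hn hξ hx) (norm_nonneg _) (by positivity)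
      _ = _ := by rw [mul_assoc, ← rpow_add this]; congr 2; ring
  have gen : ∀ (ψ : (Fin n → ℝ) → ℝ) (q D : ℝ), ξ ≤ q → ContinuousOn ψ (Uset n) →
      (∀ x ∈ Uset n, |ψ x| ≤ D * ‖x‖ ^ q) → Integrable (fun x => F x * ψ x * Ef p x) := by
    intro ψ q D hq hψ hD
    refine integrable_of_bound hn p (σ + q) hp (by linarith) (fun x => F x * ψ x)
      (hF.continuousOn.mul hψ) (C * D) fun x hx => ?_
    have := hpos x hx
    calc |F x * ψ x| = |F x| * |ψ x| := abs_mul _ _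
      _ ≤ (C * ‖x‖ ^ σ) * (D * ‖x‖ ^ q) :=
        mul_le_mul (hC x hx).1 (hD x hx) (abs_nonneg _) (by positivity)
      _ = _ := by rw [rpow_add this]; ring
  have i2 := gen _ ξ n le_rfl (cs ξ hξ).continuousOn fun x _ => sum_rpow_bound hξ x
  have i3 := gen _ (ξ + p) n (by linarith) (cs (ξ + p) (by linarith)).continuousOn
    fun x _ => sum_rpow_bound (by linarith) x
  have i4 : ∀ a : ℕ, 1 ≤ a → Integrable (fun x => F x * Hf a ξ x * Ef p x) := fun a ha =>
    gen _ ξ _ le_rfl (Hf_cont ha hξ) fun x hx => Hf_bound ha hξ hx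
  refine ⟨i1, i2, i3, i4, ?_⟩
  set T : (Fin n → ℝ) → ℝ := fun x => fderiv ℝ F x (Wf ξ x) * Ef p x
    + (ξ + 1) * (F x * (∑ i, |x i| ^ ξ) * Ef p x)
      - p * (F x * (∑ i, |x i| ^ (ξ + p)) * Ef p x) with hT
  have iT : Integrable T := (i1.add (i2.const_mul _)).sub (i3.const_mul _)
  obtain ⟨D, hD0, hD⟩ := kap_deriv_bound
  -- the cut-off integrands
  let S : ℕ → (Fin n → ℝ) → ℝ := fun k x =>
    deriv kap (Phi x / (k + 1)) * (fderiv ℝ Phi x (Wf ξ x) / (k + 1)) * F x * Ef p x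
      + kap (Phi x / (k + 1)) * T x
  have hPhi := Phi_contDiffOn n
  have hS0 : ∀ k, ∫ x, S k x = 0 := by
    intro k
    have hk : (0:ℝ) < k + 1 := by positivity
    have hκ : ContDiffOn ℝ 1 (fun x : Fin n → ℝ => kap (Phi x / (k + 1))) (Uset n) :=
      kap_contDiff.comp_contDiffOn (hPhi.div_const _)
    have hQ : ContDiffOn ℝ 1 (fun x => kap (Phi x / (k + 1)) * F x * Ef p x) (Uset n) :=
      (hκ.mul hF).mul (Ef_contDiffOn n p)
    have := div_zero_cut ξ _ hQ (Kset n (2 * (k + 1))) (Kset_compact _ _) (Kset_sub _ _) (by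
      intro x hx hxK
      have : 2 ≤ Phi x / (k + 1) := by
        by_contra hlt
        rw [not_le, div_lt_iff₀ hk] at hlt
        exact hxK (mem_Kset hx hlt.le)
      simp [kap_zero this])
    rw [← this]
    refine integral_congr_ae ?_
    filter_upwards [Uset_ae n] with x hx
    have hnh := (Uset_open n).mem_nhds hx
    have d1 : DifferentiableAt ℝ (fun x : Fin n → ℝ => kap (Phi x / (k + 1))) x :=
      (hκ.contDiffAt hnh).differentiableAt one_ne_zero
    have d2 : DifferentiableAt ℝ F x := (hF.contDiffAt hnh).differentiableAt one_ne_zero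
    have d3 : DifferentiableAt ℝ (Ef p) x :=
      ((Ef_contDiffOn n p).contDiffAt hnh).differentiableAt one_ne_zero
    have d4 : DifferentiableAt ℝ Phi x := (hPhi.contDiffAt hnh).differentiableAt one_ne_zero
    have e1 : fderiv ℝ (fun x : Fin n → ℝ => kap (Phi x / (k + 1))) x =
        deriv kap (Phi x / (k + 1)) • ((k + 1 : ℝ)⁻¹ • fderiv ℝ Phi x) := by
      have a1 : HasFDerivAt (fun x : Fin n → ℝ => Phi x / (k + 1)) ((k + 1 : ℝ)⁻¹ • fderiv ℝ Phi x) x := by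
        simpa only [div_eq_mul_inv] using d4.hasFDerivAt.mul_const ((k:ℝ) + 1)⁻¹
      exact ((kap_contDiff.differentiable one_ne_zero _).hasDerivAt.comp_hasFDerivAt x a1).fderiv
    rw [fderiv_fun_mul (d1.fun_mul d2) d3, fderiv_fun_mul d1 d2, e1]
    simp only [add_apply, smul_apply, smul_eq_mul, Ef_fderiv p ξ hx, S, hT]
    ring
  -- dominated convergence
  have hb : Integrable (fun x => D * (4 * ((⌈ξ⌉₊ : ℝ) + 1)) * |F x * ‖x‖ ^ ξ * Ef p x| + |T x|) := by
    refine Integrable.add ((gen (fun x => ‖x‖ ^ ξ) ξ 1 le_rfl ?_ ?_).abs.const_mul _) iT.abs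
    · exact (Continuous.rpow_const continuous_norm fun x => Or.inr hξ).continuousOn
    · intro x hx
      rw [abs_of_nonneg (by positivity), one_mul]
  have hlim : Tendsto (fun k => ∫ x, S k x) atTop (𝓝 (∫ x, T x)) := by
    refine tendsto_integral_of_dominated_convergence _ ?_ hb ?_ ?_
    · intro k
      have hm : (volume : Measure (Fin n → ℝ)).restrict (Uset n) = volume :=
        Measure.restrict_eq_self_of_ae_mem (Uset_ae n)
      have hcq : ContinuousOn (fun x : Fin n → ℝ => Phi x / (k + 1)) (Uset n) :=
        hPhi.continuousOn.div_const _
      have hdk : Continuous (deriv kap) := kap_contDiff.continuous_deriv le_rfl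
      have hdP : ContinuousOn (fun x : Fin n → ℝ => fderiv ℝ Phi x (Wf ξ x)) (Uset n) :=
        (hPhi.continuousOn_fderiv_of_isOpen (Uset_open n) le_rfl).clm_apply (Wf_cont hξ).continuousOn
      refine AEStronglyMeasurable.add ?_ (AEStronglyMeasurable.mul ?_ iT.1)
      · rw [← hm]
        refine ContinuousOn.aestronglyMeasurable ?_ (Uset_open n).measurableSet
        exact (((hdk.comp_continuousOn hcq).mul (hdP.div_const _)).mul hF.continuousOn).mul
          (Ef_contDiffOn n p).continuousOn
      · rw [← hm]
        refine ContinuousOn.aestronglyMeasurable ?_ (Uset_open n).measurableSet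
        exact kap_contDiff.continuous.comp_continuousOn hcq
    · intro k
      filter_upwards [Uset_ae n] with x hx
      have hk : (0:ℝ) < k + 1 := by positivity
      refine (norm_add_le _ _).trans (add_le_add ?_ ?_)
      · rw [Real.norm_eq_abs, abs_mul, abs_mul, abs_mul, abs_mul, abs_mul, abs_div, abs_of_pos hk,
          abs_of_nonneg (by positivity : 0 ≤ ‖x‖ ^ ξ)]
        have b1 := Phi_bound hξ hx
        have b2 := hD (Phi x / (k + 1)) (div_nonneg (Phi_nonneg x) hk.le)
        have b3 : |deriv kap (Phi x / (k + 1))| * (|fderiv ℝ Phi x (Wf ξ x)| / (k + 1)) ≤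
            D * (4 * ((⌈ξ⌉₊ : ℝ) + 1) * ‖x‖ ^ ξ) := by
          calc _ ≤ |deriv kap (Phi x / (k + 1))| * (((4 * ((⌈ξ⌉₊ : ℝ) + 1) * ‖x‖ ^ ξ) * Phi x) / (k + 1)) := by
                gcongr
            _ = (|deriv kap (Phi x / (k + 1))| * (Phi x / (k + 1))) * (4 * ((⌈ξ⌉₊ : ℝ) + 1) * ‖x‖ ^ ξ) := by
                ring
            _ ≤ _ := by gcongr
        calc _ ≤ D * (4 * ((⌈ξ⌉₊ : ℝ) + 1) * ‖x‖ ^ ξ) * |F x| * |Ef p x| := by gcongr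
          _ = _ := by ring
      · rw [norm_mul, Real.norm_eq_abs, Real.norm_eq_abs]
        have := kap_abs (Phi x / (k + 1))
        have := abs_nonneg (T x)
        nlinarith
    · filter_upwards with x
      refine tendsto_const_nhds.congr' ?_
      obtain ⟨N, hN⟩ := exists_nat_gt (Phi x)
      filter_upwards [eventually_ge_atTop N] with k hk
      have hkN : (N:ℝ) ≤ k := by exact_mod_cast hk
      have hk1 : (0:ℝ) < k + 1 := by positivity
      have : Phi x / (k + 1) < 1 := by rw [div_lt_one hk1]; linarith
      simp only [S, kap_deriv_zero this, kap_one this.le]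
      ring
  have : (fun k => ∫ x, S k x) = fun _ => 0 := funext hS0
  rw [this] at hlim
  exact tendsto_nhds_unique hlim tendsto_const_nhds


lemma lin_add {α : Type*} [MeasurableSpace α] {μ : Measure α} {A B C : α → ℝ} (hA : Integrable A μ)
    (hB : Integrable B μ) (hC : Integrable C μ) (u v : ℝ) :
    ∫ x, (A x + u * B x - v * C x) ∂μ = (∫ x, A x ∂μ) + u * (∫ x, B x ∂μ) - v * ∫ x, C x ∂μ := by
  have h1 : Integrable (fun x => A x + u * B x) μ := hA.add (hB.const_mul u)
  rw [integral_sub h1 (hC.const_mul v), integral_add hA (hB.const_mul u), integral_const_mul,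
    integral_const_mul]

lemma lin_sub {α : Type*} [MeasurableSpace α] {μ : Measure α} {A B C : α → ℝ} (hA : Integrable A μ)
    (hB : Integrable B μ) (hC : Integrable C μ) (u v : ℝ) :
    ∫ x, (A x - u * B x - v * C x) ∂μ = (∫ x, A x ∂μ) - u * (∫ x, B x ∂μ) - v * ∫ x, C x ∂μ := by
  have h1 : Integrable (fun x => A x - u * B x) μ := hA.sub (hB.const_mul u)
  rw [integral_sub h1 (hC.const_mul v), integral_sub hA (hB.const_mul u), integral_const_mul,
    integral_const_mul]

/-- integration by parts, Lemma 2 of the paper. -/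
theorem statement5 (n a b c : ℕ) (hn : 1 ≤ n) (ha : 1 ≤ a) (hb : 1 ≤ b) (p : ℝ) (hp : 1 ≤ p)
    (ξ s : ℝ) (hξ : 0 ≤ ξ) (hs : -dnR n a b c - ξ < s)
    (f : (Fin n → ℝ) → ℝ)
    (hhom : ∀ r : ℝ, 0 < r → ∀ x : Fin n → ℝ, x ≠ 0 → f (r • x) = r ^ s * f x)
    (hC1 : ∀ ε : Fin n → ℝ, (∀ i, ε i = 1 ∨ ε i = -1) → ∀ ρ : Equiv.Perm (Fin n),
      ∃ g : (Fin n → ℝ) → (Fin n → ℝ) →L[ℝ] ℝ,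
        ContinuousOn g (Pcell n ε ρ \ {0}) ∧
        ∀ x ∈ interior (Pcell n ε ρ),
          HasFDerivAt (fun y => f y * fabc n a b c y) (g x) x) :
    (ξ + (c : ℝ) + 1) * Mp n a b c p (fun x => f x * ∑ i, |x i| ^ ξ) =
      p * Mp n a b c p (fun x => (∑ i, |x i| ^ (ξ + p)) * f x) -
        Mp n a b c p (fun x => ∑ i, |x i| ^ ξ * x i * fderiv ℝ f x (Pi.single i 1)) -
        (a : ℝ) * b *
          Mp n a b c p (fun x => f x *
            ∑ i, ∑ j, if j ≠ i then |x i| ^ ξ * x i ^ a / (x i ^ a - x j ^ a) else 0) := by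
  have hF : HC1 (fun y => f y * fabc n a b c y) := hC1
  set F : (Fin n → ℝ) → ℝ := fun y => f y * fabc n a b c y with hFdef
  have hFhom : ∀ r : ℝ, 0 < r → ∀ x : Fin n → ℝ, x ≠ 0 →
      F (r • x) = r ^ (s + dnR n a b c - n) * F x := by
    intro r hr x hx
    simp only [hFdef]
    rw [hhom r hr x hx, fabc_smul n a b c r hr x, add_sub_assoc, rpow_add hr]
    ring
  obtain ⟨i1, i2, i3, i4, hmain⟩ := main_identity (σ := s + dnR n a b c - n) hn hp hξ
    (by linarith) hF hFhom
  have i4 := i4 a ha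
  have m1 : Mp n a b c p (fun x => f x * ∑ i, |x i| ^ ξ) =
      ∫ x, F x * (∑ i, |x i| ^ ξ) * Ef p x := by
    unfold Mp Ef
    congr 1; ext x; simp only [hFdef]; ring
  have m2 : Mp n a b c p (fun x => (∑ i, |x i| ^ (ξ + p)) * f x) =
      ∫ x, F x * (∑ i, |x i| ^ (ξ + p)) * Ef p x := by
    unfold Mp Ef
    congr 1; ext x; simp only [hFdef]; ring
  have m4 : Mp n a b c p (fun x => f x *
            ∑ i, ∑ j, if j ≠ i then |x i| ^ ξ * x i ^ a / (x i ^ a - x j ^ a) else 0) =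
      ∫ x, F x * Hf a ξ x * Ef p x := by
    unfold Mp Ef
    congr 1; ext x
    have := sum_symm (fun i => |x i| ^ ξ * x i ^ a) (fun i => x i ^ a)
    simp only [hFdef, Hf]
    rw [← this]; ring
  have m3 : Mp n a b c p (fun x => ∑ i, |x i| ^ ξ * x i * fderiv ℝ f x (Pi.single i 1)) =
      ∫ x, (fderiv ℝ F x (Wf ξ x) * Ef p x - (a * b) * (F x * Hf a ξ x * Ef p x)
        - c * (F x * (∑ i, |x i| ^ ξ) * Ef p x)) := by
    unfold Mp
    refine integral_congr_ae ?_
    filter_upwards [Uset_ae n] with x hx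
    have hnh := (Uset_open n).mem_nhds hx
    obtain ⟨L, hL, hLW⟩ := fabc_LD (b := b) (c := c) ha hx ξ
    have hFd : DifferentiableAt ℝ F x :=
      ((contDiffOn_F hn hF).contDiffAt hnh).differentiableAt one_ne_zero
    have hfd : DifferentiableAt ℝ f x := by
      have h1 : DifferentiableAt ℝ (fun y => F y * (fabc n a b c y)⁻¹) x :=
        hFd.mul (hL.differentiableAt.inv (fabc_ne ha hx))
      refine h1.congr_of_eventuallyEq ?_
      filter_upwards [hnh] with y hy
      have := fabc_ne (b := b) (c := c) ha hy
      simp only [hFdef]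
      field_simp
    have h2 : fderiv ℝ F x = f x • (fabc n a b c x • L) + fabc n a b c x • fderiv ℝ f x :=
      (hfd.hasFDerivAt.mul hL).fderiv
    have h3 := lin_sum (fderiv ℝ f x) (Wf ξ x)
    have h4 : ∑ i, |x i| ^ ξ * x i * fderiv ℝ f x (Pi.single i 1) = fderiv ℝ f x (Wf ξ x) := h3
    rw [h4, h2]
    simp only [add_apply, smul_apply, smul_eq_mul, hLW, hFdef, Ef]
    ring
  rw [lin_add i1 i2 i3] at hmain
  rw [lin_sub i1 i4 i2] at m3
  rw [m1, m2, m3, m4]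
  linear_combination hmain
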